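/- (Main frustration bound, Eq. (6)) Let S, R, A be nonempty finite types, let ψ ∈ ℂ^{S×R×A} be a unit vector, let 1 ≤ d ≤ |S|, and let Π be an orthogonal projection matrix on ℂ^S of rank d. Then the frustration 1 − ⟨ψ, (Π ⊗ 1_R ⊗ 1_A) ψ⟩ satisfies 1 − ⟨ψ, (Π ⊗ 1_R ⊗ 1_A) ψ⟩ ≥ E^(d)_{S|R}(tr_A |ψ⟩⟨ψ|) + C^(d)_{S|A}(tr_R |ψ⟩⟨ψ|). -/

import Mathlib

open Matrix
open scoped ComplexOrder Kronecker Classical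

/-- Sum of the `d` largest eigenvalues (with multiplicity, decreasing order)
of a Hermitian matrix. -/
noncomputable def sumTopEigs {n : Type*} [Fintype n] [DecidableEq n]
    {A : Matrix n n ℂ} (hA : A.IsHermitian) (d : ℕ) : ℝ :=
  ((((Finset.univ.val.map hA.eigenvalues).sort (· ≤ ·)).reverse.take d)).sum

/-- `ε^(d)(A) = 1 - Σ_{i=1}^d λ_i^↓(A)` for Hermitian `A` (junk value `0` otherwise). -/
noncomputable def epsD {n : Type*} [Fintype n] [DecidableEq n]
    (A : Matrix n n ℂ) (d : ℕ) : ℝ :=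
  if h : A.IsHermitian then 1 - sumTopEigs h d else 0

/-- `|ψ⟩⟨ψ|`. -/
noncomputable def outer {n : Type*} (ψ : n → ℂ) : Matrix n n ℂ :=
  fun i j => ψ i * star (ψ j)

/-- Partial trace over the second tensor factor. -/
noncomputable def ptraceR {S R : Type*} [Fintype R] (M : Matrix (S × R) (S × R) ℂ) :
    Matrix S S ℂ :=
  fun s s' => ∑ r, M (s, r) (s', r)

/-- Partial trace over the third tensor factor. -/
noncomputable def ptrace3 {S R A : Type*} [Fintype A] (M : Matrix (S × R × A) (S × R × A) ℂ) :
    Matrix (S × R) (S × R) ℂ :=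
  fun p q => ∑ a, M (p.1, p.2, a) (q.1, q.2, a)

/-- Partial trace over the second (middle) tensor factor. -/
noncomputable def ptrace2 {S R A : Type*} [Fintype R] (M : Matrix (S × R × A) (S × R × A) ℂ) :
    Matrix (S × A) (S × A) ℂ :=
  fun p q => ∑ r, M (p.1, r, p.2) (q.1, r, q.2)

/-- Partial trace over the second and third tensor factors. -/
noncomputable def ptrace23 {S R A : Type*} [Fintype R] [Fintype A]
    (M : Matrix (S × R × A) (S × R × A) ℂ) : Matrix S S ℂ :=
  fun s s' => ∑ r, ∑ a, M (s, r, a) (s', r, a)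

/-- Convex-roof extension `E^(d)_{S|R}`: the infimum over all finite pure-state
convex decompositions `ρ = Σ_k p_k |ψ_k⟩⟨ψ_k|` of `Σ_k p_k ε^(d)(tr_R |ψ_k⟩⟨ψ_k|)`. -/
noncomputable def convRoofE {S R : Type*} [Fintype S] [Fintype R] [DecidableEq S]
    (d : ℕ) (ρ : Matrix (S × R) (S × R) ℂ) : ℝ :=
  sInf { e : ℝ | ∃ (m : ℕ) (p : Fin m → ℝ) (ψ : Fin m → (S × R → ℂ)),
    (∀ k, 0 ≤ p k) ∧ (∑ k, p k = 1) ∧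
    (∀ k, star (ψ k) ⬝ᵥ ψ k = 1) ∧
    (ρ = ∑ k, (p k : ℂ) • outer (ψ k)) ∧
    e = ∑ k, p k * epsD (ptraceR (outer (ψ k))) d }

/-- Classical correlations `C^(d)_{S|A}`:
`ε^(d)(tr_A ρ)` minus the infimum over all POVMs `{M_x}` on `A` of
`Σ_x p_x ε^(d)(p_x⁻¹ tr_A((1_S ⊗ M_x) ρ))`, where `p_x = tr((1_S ⊗ M_x) ρ)`
and terms with `p_x = 0` are omitted. -/
noncomputable def classC {S A : Type*} [Fintype S] [Fintype A] [DecidableEq S] [DecidableEq A]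
    (d : ℕ) (ρ : Matrix (S × A) (S × A) ℂ) : ℝ :=
  epsD (ptraceR ρ) d -
  sInf { e : ℝ | ∃ (m : ℕ) (M : Fin m → Matrix A A ℂ),
    (∀ x, (M x).PosSemidef) ∧ (∑ x, M x = 1) ∧
    e = ∑ x,
      (if (((1 : Matrix S S ℂ) ⊗ₖ M x) * ρ).trace = 0 then 0
       else ((((1 : Matrix S S ℂ) ⊗ₖ M x) * ρ).trace).re *
         epsD (((((1 : Matrix S S ℂ) ⊗ₖ M x) * ρ).trace)⁻¹ •
           ptraceR (((1 : Matrix S S ℂ) ⊗ₖ M x) * ρ)) d) }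

/-- The `d` largest values of a finite real family are attained on a set of `d` indices
separated from its complement by a threshold. -/
lemma exists_finset_sum_take_sort {n : Type*} [Fintype n] (f : n → ℝ) {N : ℕ} (e : Fin N ≃ n)
    (he : Antitone (f ∘ e)) (d : ℕ) (hd1 : 1 ≤ d) (hdn : d ≤ N) :
    ∃ (T : Finset n) (t : ℝ), T.card = d ∧ (∀ i ∈ T, t ≤ f i) ∧ (∀ i ∉ T, f i ≤ t) ∧
      (((Finset.univ.val.map f).sort (· ≤ ·)).reverse.take d).sum = ∑ i ∈ T, f i := by
  have hlist : ((Finset.univ.val.map f).sort (· ≤ ·)).reverse = List.ofFn (f ∘ e) := by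
    apply List.Perm.eq_of_pairwise (le := (· ≥ ·))
    · intro a b _ _ h1 h2
      exact le_antisymm h2 h1
    · rw [List.pairwise_reverse]
      exact Multiset.pairwise_sort _ _
    · rw [List.pairwise_ofFn]
      exact fun i j hij => he hij.le
    · refine (List.reverse_perm _).trans ?_
      rw [← Multiset.coe_eq_coe, Multiset.sort_eq]
      have h : (Finset.univ : Finset n).val = (Finset.univ : Finset (Fin N)).val.map e := by
        rw [← Finset.map_univ_equiv e]
        rfl
      rw [h, Multiset.map_map]
      exact Fin.univ_val_map _
  refine ⟨(Finset.univ.filter fun j : Fin N => (j : ℕ) < d).map e.toEmbedding,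
    f (e ⟨d - 1, by omega⟩), ?_, ?_, ?_, ?_⟩
  · rw [Finset.card_map, Fin.card_filter_val_lt, min_eq_right hdn]
  · intro i hi
    obtain ⟨j, hj, rfl⟩ := Finset.mem_map.1 hi
    refine he ?_
    simp only [Finset.mem_filter, Finset.mem_univ, true_and] at hj
    exact Fin.le_def.2 (by simp; omega)
  · intro i hi
    obtain ⟨j, rfl⟩ := e.surjective i
    refine he ?_
    have hj : ¬ (j : ℕ) < d := fun h => hi (by simp [h])
    exact Fin.le_def.2 (by simp; omega)
  · rw [hlist, List.sum_take_ofFn, Finset.sum_map]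
    rfl

/-- A weighted sum with weights in `[0, 1]` is at most the sum over an upper set of the same
total weight. -/
lemma sum_mul_le_sum_of_threshold {n : Type*} [Fintype n] (f w : n → ℝ) (T : Finset n) (t : ℝ)
    (hw0 : ∀ i, 0 ≤ w i) (hw1 : ∀ i, w i ≤ 1) (hsum : ∑ i, w i = T.card)
    (hT : ∀ i ∈ T, t ≤ f i) (hT' : ∀ i ∉ T, f i ≤ t) :
    ∑ i, w i * f i ≤ ∑ i ∈ T, f i := by
  have h : ∑ i, w i * (f i - t) ≤ ∑ i ∈ T, (f i - t) := by
    rw [← Finset.sum_add_sum_compl T]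
    have h1 : ∑ i ∈ T, w i * (f i - t) ≤ ∑ i ∈ T, (f i - t) :=
      Finset.sum_le_sum fun i hi =>
        mul_le_of_le_one_left (sub_nonneg.2 (hT i hi)) (hw1 i)
    have h2 : ∑ i ∈ Tᶜ, w i * (f i - t) ≤ 0 :=
      Finset.sum_nonpos fun i hi => mul_nonpos_of_nonneg_of_nonpos (hw0 i)
        (sub_nonpos.2 (hT' i (Finset.mem_compl.1 hi)))
    linarith
  simp only [mul_sub, Finset.sum_sub_distrib, ← Finset.sum_mul, hsum, Finset.sum_const,
    nsmul_eq_mul] at h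
  linarith

lemma exists_finset_sumTopEigs {n : Type*} [Fintype n] [DecidableEq n] {A : Matrix n n ℂ}
    (hA : A.IsHermitian) (d : ℕ) (hd1 : 1 ≤ d) (hdn : d ≤ Fintype.card n) :
    ∃ (T : Finset n) (t : ℝ), T.card = d ∧ (∀ i ∈ T, t ≤ hA.eigenvalues i) ∧
      (∀ i ∉ T, hA.eigenvalues i ≤ t) ∧ sumTopEigs hA d = ∑ i ∈ T, hA.eigenvalues i := by
  refine exists_finset_sum_take_sort hA.eigenvalues
    (Fintype.equivOfCardEq (Fintype.card_fin (Fintype.card n))) ?_ d hd1 hdn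
  intro i j hij
  simpa [Matrix.IsHermitian.eigenvalues] using hA.eigenvalues₀_antitone hij

/-- Orthogonal projection matrices of trace (equivalently, rank) `d`. -/
structure IsOrthProj {n : Type*} [Fintype n] (P : Matrix n n ℂ) (d : ℕ) : Prop where
  isHermitian : P.IsHermitian
  mul_self : P * P = P
  trace_eq : P.trace = d

namespace IsOrthProj

variable {n : Type*} [Fintype n] {P : Matrix n n ℂ} {d : ℕ}

lemma of_rank [DecidableEq n] (hP : P.IsHermitian) (hP2 : P * P = P) (hrank : P.rank = d) :
    IsOrthProj P d where
  isHermitian := hP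
  mul_self := hP2
  trace_eq := by
    have hidem : IsIdempotentElem P.toLin' := by
      rw [IsIdempotentElem, Module.End.mul_eq_comp, ← Matrix.toLin'_mul, hP2]
    rw [← Matrix.trace_toLin'_eq,
      (LinearMap.IsIdempotentElem.isProj_range _ hidem).trace, ← hrank]
    rfl

lemma conj [DecidableEq n] (hP : IsOrthProj P d) {U V : Matrix n n ℂ} (hUV : U * V = 1)
    (hV : V = Uᴴ) : IsOrthProj (V * P * U) d where
  isHermitian := by
    subst hV
    exact isHermitian_conjTranspose_mul_mul U hP.isHermitian
  mul_self := by
    calc V * P * U * (V * P * U) = V * P * (U * V) * (P * U) := by simp only [mul_assoc]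
      _ = V * (P * P) * U := by rw [hUV, mul_one]; simp only [mul_assoc]
      _ = V * P * U := by rw [hP.mul_self]
  trace_eq := by
    rw [trace_mul_comm, ← mul_assoc, hUV, one_mul, hP.trace_eq]

lemma diagonal_indicator [DecidableEq n] (T : Finset n) :
    IsOrthProj (diagonal fun i => if i ∈ T then (1 : ℂ) else 0) T.card where
  isHermitian := by
    rw [isHermitian_diagonal_iff]
    intro i
    split_ifs <;> simp [IsSelfAdjoint]
  mul_self := by simp [diagonal_mul_diagonal]
  trace_eq := by simp [trace_diagonal]

lemma normSq_diag_le (hP : IsOrthProj P d) (i : n) : Complex.normSq (P i i) ≤ (P i i).re := by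
  have h : (P i i).re = ∑ j, Complex.normSq (P i j) := by
    conv_lhs => rw [← hP.mul_self]
    rw [mul_apply, Complex.re_sum]
    refine Finset.sum_congr rfl fun j _ => ?_
    rw [← hP.isHermitian.apply j i]
    simp [Complex.normSq_apply]
  rw [h]
  exact Finset.single_le_sum (f := fun j => Complex.normSq (P i j))
    (fun j _ => Complex.normSq_nonneg _) (Finset.mem_univ i)

lemma diag_nonneg (hP : IsOrthProj P d) (i : n) : 0 ≤ (P i i).re :=
  (Complex.normSq_nonneg _).trans (hP.normSq_diag_le i)

lemma diag_le_one (hP : IsOrthProj P d) (i : n) : (P i i).re ≤ 1 := by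
  have h := hP.normSq_diag_le i
  rw [Complex.normSq_apply] at h
  nlinarith [mul_self_nonneg (P i i).im, hP.diag_nonneg i]

lemma sum_diag (hP : IsOrthProj P d) : ∑ i, (P i i).re = d := by
  have h := congrArg Complex.re hP.trace_eq
  simpa [trace] using h

end IsOrthProj

lemma trace_mul_eq_sum_eigenvalues {n : Type*} [Fintype n] [DecidableEq n] {A : Matrix n n ℂ}
    (hA : A.IsHermitian) (P : Matrix n n ℂ) :
    (P * A).trace = ∑ i, ((star (hA.eigenvectorUnitary : Matrix n n ℂ) * P *
      (hA.eigenvectorUnitary : Matrix n n ℂ)) i i) * (hA.eigenvalues i : ℂ) := by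
  conv_lhs => rw [hA.spectral_theorem, Unitary.conjStarAlgAut_apply, ← mul_assoc,
    trace_mul_comm, ← mul_assoc, ← mul_assoc]
  simp [trace, mul_diagonal]

/-- **Ky Fan's inequality** for orthogonal projections of rank `d`. -/
lemma re_trace_mul_le {n : Type*} [Fintype n] [DecidableEq n] {A P : Matrix n n ℂ}
    (hA : A.IsHermitian) {d : ℕ} (hd1 : 1 ≤ d) (hdn : d ≤ Fintype.card n)
    (hP : IsOrthProj P d) : ((P * A).trace).re ≤ 1 - epsD A d := by
  obtain ⟨T, t, hcard, hT, hT', hsum⟩ := exists_finset_sumTopEigs hA d hd1 hdn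
  have hQ := hP.conj (Unitary.coe_mul_star_self hA.eigenvectorUnitary) rfl
  rw [epsD, dif_pos hA, hsum, sub_sub_cancel, trace_mul_eq_sum_eigenvalues hA, Complex.re_sum]
  simp only [Complex.re_mul_ofReal]
  exact sum_mul_le_sum_of_threshold _ _ T t hQ.diag_nonneg hQ.diag_le_one
    (by rw [hcard]; exact hQ.sum_diag) hT hT'

/-- Ky Fan's inequality is attained. -/
lemma exists_re_trace_mul_eq {n : Type*} [Fintype n] [DecidableEq n] {A : Matrix n n ℂ}
    (hA : A.IsHermitian) {d : ℕ} (hd1 : 1 ≤ d) (hdn : d ≤ Fintype.card n) :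
    ∃ P : Matrix n n ℂ, IsOrthProj P d ∧ ((P * A).trace).re = 1 - epsD A d := by
  obtain ⟨T, t, hcard, -, -, hsum⟩ := exists_finset_sumTopEigs hA d hd1 hdn
  have hU : star (hA.eigenvectorUnitary : Matrix n n ℂ) * hA.eigenvectorUnitary = 1 :=
    Unitary.coe_star_mul_self hA.eigenvectorUnitary
  have hD := IsOrthProj.diagonal_indicator T
  rw [hcard] at hD
  refine ⟨_, hD.conj hU (star_star _).symm, ?_⟩
  rw [epsD, dif_pos hA, hsum, sub_sub_cancel, trace_mul_eq_sum_eigenvalues hA]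
  have h : ∀ D : Matrix n n ℂ, star (hA.eigenvectorUnitary : Matrix n n ℂ) *
      ((hA.eigenvectorUnitary : Matrix n n ℂ) * D * star (hA.eigenvectorUnitary : Matrix n n ℂ)) *
      (hA.eigenvectorUnitary : Matrix n n ℂ) = D := by
    intro D
    rw [← mul_assoc, ← mul_assoc, hU, one_mul, mul_assoc, hU, mul_one]
  rw [h]
  simp [Complex.re_sum]

open scoped MatrixOrder in
lemma exists_eq_conjTranspose_mul_self {n : Type*} [Fintype n] [DecidableEq n] {M : Matrix n n ℂ}
    (hM : M.PosSemidef) : ∃ B : Matrix n n ℂ, M = Bᴴ * B :=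
  CStarAlgebra.nonneg_iff_eq_star_mul_self.mp hM.nonneg

lemma ptraceR_outer {S R : Type*} [Fintype R] (φ : S × R → ℂ) :
    ptraceR (outer φ) = (of fun s r => φ (s, r)) * (of fun s r => φ (s, r))ᴴ := by
  ext s s'
  simp [ptraceR, outer, mul_apply]

lemma trace_ptraceR {S R : Type*} [Fintype S] [Fintype R] (M : Matrix (S × R) (S × R) ℂ) :
    (ptraceR M).trace = M.trace := by
  simp [trace, ptraceR, Fintype.sum_prod_type]

lemma ptraceR_smul {S R : Type*} [Fintype R] (c : ℂ) (M : Matrix (S × R) (S × R) ℂ) :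
    ptraceR (c • M) = c • ptraceR M := by
  ext s s'
  simp [ptraceR, Finset.mul_sum]

lemma trace_outer {n : Type*} [Fintype n] (φ : n → ℂ) : (outer φ).trace = star φ ⬝ᵥ φ := by
  simp [trace, outer, dotProduct, mul_comm]

lemma posSemidef_ptraceR_outer {S R : Type*} [Fintype S] [Fintype R] (φ : S × R → ℂ) :
    (ptraceR (outer φ)).PosSemidef := by
  rw [ptraceR_outer]
  exact posSemidef_self_mul_conjTranspose _

lemma IsOrthProj.re_trace_mul_le_trace {n : Type*} [Fintype n] [DecidableEq n]
    {P Y : Matrix n n ℂ} {d : ℕ} (hP : IsOrthProj P d) (hY : Y.PosSemidef) :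
    ((P * Y).trace).re ≤ (Y.trace).re := by
  have hH : (1 - P)ᴴ = 1 - P := by rw [conjTranspose_sub, conjTranspose_one, hP.isHermitian.eq]
  have hidem : (1 - P) * (1 - P) = 1 - P := by
    simp [mul_sub, sub_mul, hP.mul_self]
  have h := (hY.mul_mul_conjTranspose_same (1 - P)).trace_nonneg
  rw [hH, trace_mul_comm, ← mul_assoc, hidem, sub_mul, one_mul, trace_sub, Complex.le_def] at h
  simpa using h.1

lemma epsD_nonneg {n : Type*} [Fintype n] [DecidableEq n] {Y : Matrix n n ℂ}
    (hY : Y.PosSemidef) (htr : Y.trace = 1) {d : ℕ} (hd1 : 1 ≤ d) (hdn : d ≤ Fintype.card n) :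
    0 ≤ epsD Y d := by
  obtain ⟨P, hP, h⟩ := exists_re_trace_mul_eq hY.isHermitian hd1 hdn
  have h2 := hP.re_trace_mul_le_trace hY
  rw [htr, Complex.one_re] at h2
  linarith

/-- The convex roof is bounded by the value of any pure-state decomposition indexed by a finite
type. -/
lemma convRoofE_le {S R ι : Type*} [Fintype S] [Fintype R] [DecidableEq S] [Fintype ι]
    {d : ℕ} (hd1 : 1 ≤ d) (hdn : d ≤ Fintype.card S) {ρ : Matrix (S × R) (S × R) ℂ}
    (q : ι → ℝ) (χ : ι → S × R → ℂ) (hq : ∀ k, 0 ≤ q k) (hsum : ∑ k, q k = 1)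
    (hχ : ∀ k, star (χ k) ⬝ᵥ χ k = 1) (hρ : ρ = ∑ k, (q k : ℂ) • outer (χ k)) :
    convRoofE d ρ ≤ ∑ k, q k * epsD (ptraceR (outer (χ k))) d := by
  refine csInf_le ⟨0, ?_⟩ ?_
  · rintro e ⟨m, p, φ, hp, -, hφ, -, rfl⟩
    exact Finset.sum_nonneg fun k _ => mul_nonneg (hp k)
      (epsD_nonneg (posSemidef_ptraceR_outer _)
        (by rw [trace_ptraceR, trace_outer, hφ]) hd1 hdn)
  · have e := (Fintype.equivFin ι).symm
    refine ⟨Fintype.card ι, q ∘ e, χ ∘ e, fun k => hq _, ?_, fun k => hχ _, ?_, ?_⟩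
    · rw [← hsum]
      exact e.sum_comp q
    · rw [hρ]
      exact (e.sum_comp fun k => (q k : ℂ) • outer (χ k)).symm
    · exact (e.sum_comp fun k => q k * epsD (ptraceR (outer (χ k))) d).symm

lemma exists_normalized {n : Type*} [Fintype n] [Nonempty n] (φ : n → ℂ) :
    ∃ (q : ℝ) (χ : n → ℂ), 0 ≤ q ∧ star χ ⬝ᵥ χ = 1 ∧ outer φ = (q : ℂ) • outer χ ∧
      star φ ⬝ᵥ φ = q := by
  have hself : star φ ⬝ᵥ φ = ((∑ i, Complex.normSq (φ i) : ℝ) : ℂ) := by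
    simp [dotProduct, Complex.normSq_eq_conj_mul_self]
  have hnn : 0 ≤ ∑ i, Complex.normSq (φ i) := Finset.sum_nonneg fun i _ => Complex.normSq_nonneg _
  by_cases h0 : φ = 0
  · subst h0
    refine ⟨0, Pi.single (Classical.arbitrary n) 1, le_rfl, ?_, ?_, ?_⟩
    · simp
    · ext i j
      simp [outer]
    · simp
  · set q := ∑ i, Complex.normSq (φ i) with hq
    have hqpos : 0 < q := by
      refine lt_of_le_of_ne hnn fun h => h0 ?_
      rw [← dotProduct_star_self_eq_zero, hself, ← h, Complex.ofReal_zero]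
    have hsq : ((√q : ℝ) : ℂ) * (√q : ℝ) = (q : ℂ) := by
      rw [← Complex.ofReal_mul, Real.mul_self_sqrt hnn]
    have hne : ((√q : ℝ) : ℂ) ≠ 0 := by
      exact_mod_cast (Real.sqrt_pos.2 hqpos).ne'
    have hqne : (q : ℂ) ≠ 0 := by exact_mod_cast hqpos.ne'
    refine ⟨q, ((√q : ℝ) : ℂ)⁻¹ • φ, hnn, ?_, ?_, hself⟩
    · rw [star_smul, smul_dotProduct, dotProduct_smul, hself, ← hsq]
      simp only [smul_eq_mul, star_inv₀, Complex.star_def, Complex.conj_ofReal]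
      field_simp
    · ext i j
      simp only [outer, Matrix.smul_apply, Pi.smul_apply, smul_eq_mul, star_mul', star_inv₀,
        Complex.star_def, Complex.conj_ofReal]
      rw [← hsq]
      field_simp

/-- Contraction of the third tensor factor of `ψ` with the (unconjugated) vector `v`. -/
def contractThird {S R A : Type*} [Fintype A] (v : A → ℂ) (ψ : S × R × A → ℂ) : S × R → ℂ :=
  fun p => ∑ a, v a * ψ (p.1, p.2, a)

lemma sum_outer_contractThird {S R A : Type*} [Fintype A] [DecidableEq A] {ι : Type*} [Fintype ι]
    (B : ι → Matrix A A ℂ) (hB : ∑ x, (B x)ᴴ * B x = 1) (ψ : S × R × A → ℂ) :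
    ∑ k : ι × A, outer (contractThird (B k.1 k.2) ψ) = ptrace3 (outer ψ) := by
  ext p q
  have hB' : ∀ b a, ∑ x, ∑ y, star (B x y b) * B x y a = if b = a then 1 else 0 := by
    intro b a
    have := congrFun (congrFun hB b) a
    simpa [Matrix.sum_apply, mul_apply, one_apply] using this
  calc (∑ k : ι × A, outer (contractThird (B k.1 k.2) ψ)) p q
      = ∑ x, ∑ y, ∑ a, ∑ b, (star (B x y b) * B x y a) *
          (ψ (p.1, p.2, a) * star (ψ (q.1, q.2, b))) := by
        simp only [Matrix.sum_apply, Fintype.sum_prod_type, outer, contractThird, star_sum,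
          Finset.sum_mul_sum, star_mul']
        refine Finset.sum_congr rfl fun x _ => Finset.sum_congr rfl fun y _ =>
          Finset.sum_congr rfl fun a _ => Finset.sum_congr rfl fun b _ => ?_
        ring
    _ = ∑ a, ∑ b, (∑ x, ∑ y, star (B x y b) * B x y a) *
          (ψ (p.1, p.2, a) * star (ψ (q.1, q.2, b))) := by
        simp only [Finset.sum_mul]
        simp only [Finset.sum_comm (s := (Finset.univ : Finset ι)) (t := (Finset.univ : Finset A))]
        rw [Finset.sum_comm]
        refine Finset.sum_congr rfl fun a _ => ?_
        rw [Finset.sum_comm]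
    _ = ptrace3 (outer ψ) p q := by
        simp only [hB']
        simp [ptrace3, outer]

lemma ptraceR_measure {S R A : Type*} [Fintype S] [Fintype R] [Fintype A] [DecidableEq S]
    (B : Matrix A A ℂ) (ψ : S × R × A → ℂ) :
    ptraceR (((1 : Matrix S S ℂ) ⊗ₖ (Bᴴ * B)) * ptrace2 (outer ψ)) =
      ∑ y, ptraceR (outer (contractThird (B y) ψ)) := by
  ext s s'
  calc ptraceR (((1 : Matrix S S ℂ) ⊗ₖ (Bᴴ * B)) * ptrace2 (outer ψ)) s s'
      = ∑ b, ∑ a, ∑ y, ∑ r, (star (B y b) * B y a) * (ψ (s, r, a) * star (ψ (s', r, b))) := by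
        simp only [ptraceR, mul_apply, kroneckerMap_apply, Fintype.sum_prod_type, one_apply,
          ite_mul, one_mul, zero_mul, ptrace2, outer, conjTranspose_apply, Finset.sum_mul_sum,
          Finset.sum_const_zero, Finset.sum_ite_irrel]
        simp
    _ = ∑ y, ∑ r, ∑ a, ∑ b, (star (B y b) * B y a) * (ψ (s, r, a) * star (ψ (s', r, b))) := by
        rw [Finset.sum_comm]
        refine (Finset.sum_congr rfl fun a _ => Finset.sum_comm).trans ?_
        rw [Finset.sum_comm]
        refine Finset.sum_congr rfl fun y _ => ?_
        exact (Finset.sum_congr rfl fun a _ => Finset.sum_comm).trans Finset.sum_comm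
    _ = (∑ y, ptraceR (outer (contractThird (B y) ψ))) s s' := by
        simp only [Matrix.sum_apply, ptraceR, outer, contractThird, star_sum,
          Finset.sum_mul_sum, star_mul']
        refine Finset.sum_congr rfl fun x _ => Finset.sum_congr rfl fun y _ =>
          Finset.sum_congr rfl fun a _ => Finset.sum_congr rfl fun b _ => ?_
        ring

lemma ptraceR_ptrace2_outer {S R A : Type*} [Fintype R] [Fintype A] (ψ : S × R × A → ℂ) :
    ptraceR (ptrace2 (outer ψ)) = ptraceR (outer ψ) := by
  ext s s'
  simp only [ptraceR, ptrace2, Fintype.sum_prod_type]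
  exact Finset.sum_comm

lemma star_dotProduct_kronecker_one_mulVec {S T : Type*} [Fintype S] [Fintype T] [DecidableEq T]
    (P : Matrix S S ℂ) (φ : S × T → ℂ) :
    star φ ⬝ᵥ ((P ⊗ₖ (1 : Matrix T T ℂ)) *ᵥ φ) = (P * ptraceR (outer φ)).trace := by
  simp only [dotProduct, mulVec, Fintype.sum_prod_type, kroneckerMap_apply, one_apply, trace,
    diag_apply, mul_apply, ptraceR, outer, Finset.mul_sum]
  refine Finset.sum_congr rfl fun s _ => ?_
  rw [Finset.sum_comm]
  refine Finset.sum_congr rfl fun s' _ => Finset.sum_congr rfl fun t _ => ?_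
  simp
  ring

lemma IsHermitian.im_trace_mul {n : Type*} [Fintype n] {P Y : Matrix n n ℂ} (hP : P.IsHermitian)
    (hY : Y.IsHermitian) : ((P * Y).trace).im = 0 := by
  rw [← Complex.conj_eq_iff_im, ← Complex.star_def, ← trace_conjTranspose, conjTranspose_mul,
    hP.eq, hY.eq, trace_mul_comm]

/-- Concavity of `ε^(d)` on a mixture, for unnormalized states. -/
lemma sum_mul_epsD_le {n ι : Type*} [Fintype n] [DecidableEq n] [Fintype ι] {d : ℕ} (hd1 : 1 ≤ d)
    (hdn : d ≤ Fintype.card n) (q : ι → ℝ) (hq : ∀ y, 0 ≤ q y) (Y : ι → Matrix n n ℂ)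
    (hY : ∀ y, (Y y).IsHermitian) (X : Matrix n n ℂ) (hX : X = ∑ y, (q y : ℂ) • Y y)
    (htr : X.trace = ((∑ y, q y : ℝ) : ℂ)) :
    ∑ y, q y * epsD (Y y) d ≤
      if X.trace = 0 then 0 else X.trace.re * epsD ((X.trace)⁻¹ • X) d := by
  split_ifs with h0
  · rw [htr, Complex.ofReal_eq_zero, Finset.sum_eq_zero_iff_of_nonneg fun y _ => hq y] at h0
    exact (Finset.sum_eq_zero fun y hy => by rw [h0 y hy, zero_mul]).le
  · rw [htr] at h0 ⊢
    set p := ∑ y, q y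
    have hp : p ≠ 0 := by exact_mod_cast h0
    have hXH : X.IsHermitian := by
      rw [hX, IsHermitian, conjTranspose_sum]
      exact Finset.sum_congr rfl fun y _ => by simp [(hY y).eq]
    have hXH' : ((p : ℂ)⁻¹ • X).IsHermitian := by
      rw [IsHermitian, conjTranspose_smul, hXH.eq]
      simp
    obtain ⟨P, hP, hPX⟩ := exists_re_trace_mul_eq hXH' hd1 hdn
    have hle : ∀ y, q y * epsD (Y y) d ≤ q y - q y * ((P * Y y).trace).re := by
      intro y
      have := re_trace_mul_le (hY y) hd1 hdn hP
      nlinarith [hq y]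
    refine (Finset.sum_le_sum fun y _ => hle y).trans (le_of_eq ?_)
    have hval : ((P * X).trace).re = ∑ y, q y * ((P * Y y).trace).re := by
      rw [hX, Finset.mul_sum, trace_sum, Complex.re_sum]
      simp
    rw [mul_smul_comm, trace_smul, smul_eq_mul, ← Complex.ofReal_inv, Complex.re_ofReal_mul,
      hval] at hPX
    have hpe : p * epsD ((p : ℂ)⁻¹ • X) d = p - ∑ y, q y * ((P * Y y).trace).re := by
      rw [← Complex.ofReal_inv]
      rw [show epsD (((p⁻¹ : ℝ) : ℂ) • X) d = 1 - p⁻¹ * ∑ y, q y * ((P * Y y).trace).re by linarith]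
      field_simp
    rw [Finset.sum_sub_distrib, Complex.ofReal_re, hpe]

/-- For a pure state on `S × R × A`, every measurement on `A` induces a decomposition of the state
on `S × R`, whose average entanglement is at most the average `ε^(d)` of the post-measurement
states on `S`. -/
lemma convRoofE_le_povm {S R A : Type*} [Fintype S] [Fintype R] [Fintype A]
    [DecidableEq S] [DecidableEq A] [Nonempty S] [Nonempty R]
    (ψ : S × R × A → ℂ) (hψ : star ψ ⬝ᵥ ψ = 1) {d : ℕ} (hd1 : 1 ≤ d) (hdn : d ≤ Fintype.card S)
    {m : ℕ} (M : Fin m → Matrix A A ℂ) (hM : ∀ x, (M x).PosSemidef) (hM1 : ∑ x, M x = 1) :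
    convRoofE d (ptrace3 (outer ψ)) ≤ ∑ x,
      (if (((1 : Matrix S S ℂ) ⊗ₖ M x) * ptrace2 (outer ψ)).trace = 0 then 0
       else ((((1 : Matrix S S ℂ) ⊗ₖ M x) * ptrace2 (outer ψ)).trace).re *
         epsD (((((1 : Matrix S S ℂ) ⊗ₖ M x) * ptrace2 (outer ψ)).trace)⁻¹ •
           ptraceR (((1 : Matrix S S ℂ) ⊗ₖ M x) * ptrace2 (outer ψ))) d) := by
  choose B hB using fun x => exists_eq_conjTranspose_mul_self (hM x)
  have hB1 : ∑ x, (B x)ᴴ * B x = 1 := by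
    rw [← hM1]
    exact Finset.sum_congr rfl fun x _ => (hB x).symm
  choose q χ hq hχ houter hnorm using
    fun k : Fin m × A => exists_normalized (contractThird (B k.1 k.2) ψ)
  have hρ : ptrace3 (outer ψ) = ∑ k, (q k : ℂ) • outer (χ k) := by
    rw [← sum_outer_contractThird B hB1 ψ]
    exact Finset.sum_congr rfl fun k _ => houter k
  have hsum : ∑ k, q k = 1 := by
    have h : (ptrace3 (outer ψ)).trace = 1 := by
      rw [← hψ, ← trace_outer]
      simp [trace, ptrace3, Fintype.sum_prod_type]
    rw [hρ, trace_sum] at h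
    simp only [trace_smul, trace_outer, hχ, smul_eq_mul, mul_one] at h
    exact_mod_cast h
  refine (convRoofE_le hd1 hdn q χ hq hsum hχ hρ).trans ?_
  rw [Fintype.sum_prod_type]
  refine Finset.sum_le_sum fun x _ => ?_
  have hX : ptraceR (((1 : Matrix S S ℂ) ⊗ₖ M x) * ptrace2 (outer ψ)) =
      ∑ y, (q (x, y) : ℂ) • ptraceR (outer (χ (x, y))) := by
    rw [hB x, ptraceR_measure]
    exact Finset.sum_congr rfl fun y _ => by rw [houter (x, y), ptraceR_smul]
  rw [← trace_ptraceR]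
  refine sum_mul_epsD_le hd1 hdn (fun y => q (x, y)) (fun y => hq _)
    (fun y => ptraceR (outer (χ (x, y)))) (fun y => (posSemidef_ptraceR_outer _).isHermitian)
    _ hX ?_
  rw [hX, trace_sum]
  simp [trace_ptraceR, trace_outer, hχ]

/-- Main frustration bound, Eq. (6): for a unit vector
`ψ ∈ ℂ^{S×R×A}`, `1 ≤ d ≤ |S|`, and a rank-`d` orthogonal projection `P` on `ℂ^S`,
the frustration `1 - ⟨ψ, (P ⊗ 1_R ⊗ 1_A) ψ⟩` is at least
`E^(d)_{S|R}(tr_A |ψ⟩⟨ψ|) + C^(d)_{S|A}(tr_R |ψ⟩⟨ψ|)`. -/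
theorem stmt4 {S R A : Type*} [Fintype S] [Fintype R] [Fintype A]
    [DecidableEq S] [DecidableEq R] [DecidableEq A]
    [Nonempty S] [Nonempty R] [Nonempty A]
    (ψ : S × R × A → ℂ) (hψ : star ψ ⬝ᵥ ψ = 1)
    (d : ℕ) (hd1 : 1 ≤ d) (hdn : d ≤ Fintype.card S)
    (P : Matrix S S ℂ) (hP : P.IsHermitian) (hP2 : P * P = P)
    (hrank : P.rank = d) :
    ((convRoofE d (ptrace3 (outer ψ)) + classC d (ptrace2 (outer ψ)) : ℝ) : ℂ) ≤
      1 - star ψ ⬝ᵥ ((P ⊗ₖ (1 : Matrix (R × A) (R × A) ℂ)) *ᵥ ψ) := by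
  have hY : (ptraceR (outer ψ)).IsHermitian := (posSemidef_ptraceR_outer ψ).isHermitian
  have hE : convRoofE d (ptrace3 (outer ψ)) + classC d (ptrace2 (outer ψ)) ≤
      epsD (ptraceR (outer ψ)) d := by
    rw [classC, ptraceR_ptrace2_outer]
    rw [← le_sub_iff_add_le, sub_sub_cancel]
    refine le_csInf ⟨_, 1, fun _ => 1, fun _ => PosSemidef.one, by simp, rfl⟩ ?_
    rintro e ⟨m, M, hM, hM1, rfl⟩
    exact convRoofE_le_povm ψ hψ hd1 hdn M hM hM1
  have hle := re_trace_mul_le hY hd1 hdn (IsOrthProj.of_rank hP hP2 hrank)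
  rw [star_dotProduct_kronecker_one_mulVec, Complex.le_def]
  refine ⟨?_, ?_⟩
  · simp only [Complex.ofReal_re, Complex.sub_re, Complex.one_re]
    linarith
  · simp [IsHermitian.im_trace_mul hP hY]
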